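/- arXiv:2001.02022 — 2 statements merged into one kernel-verified Lean document; each statement's English description precedes it below -/
import Mathlib

section
/- For every integer k with 0 ≤ k ≤ n, the function g_k defined by g_k(ξ) = inf{ ∫ j* dν : ν a Borel probability measure on Sym_n with support contained in G_k, finite first moment and barycenter ξ } satisfies g_k*(z) = j_k(z) for every z ∈ Sym_n, where g_k* is the Fenchel conjugate of g_k. -/
open MeasureTheory

noncomputable section

/-- The trace (Frobenius) inner product `z·ξ = trace(zξ)` on symmetric matrices. -/
def mdot {n : ℕ} (z ξ : Matrix (Fin n) (Fin n) ℝ) : ℝ := Matrix.trace (z * ξ)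

/-- Fenchel conjugate of a function on the space of real symmetric `n×n` matrices:
`f*(ξ) = sup { z·ξ - f z : z ∈ Sym_n }`. -/
def fstar {n : ℕ} (f : Matrix (Fin n) (Fin n) ℝ → ℝ) (ξ : Matrix (Fin n) (Fin n) ℝ) : ℝ :=
  sSup { r : ℝ | ∃ z : Matrix (Fin n) (Fin n) ℝ, z.IsSymm ∧ r = mdot z ξ - f z }

/-- `j_k(z) = sup { z·ξ - j*(ξ) : ξ ∈ G_k }`, where `G_k` is the set of symmetric
matrices of rank at most `k`. -/
def jk {n : ℕ} (j : Matrix (Fin n) (Fin n) ℝ → ℝ) (k : ℕ) (z : Matrix (Fin n) (Fin n) ℝ) : ℝ :=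
  sSup { r : ℝ | ∃ ξ : Matrix (Fin n) (Fin n) ℝ, ξ.IsSymm ∧ ξ.rank ≤ k ∧
    r = mdot z ξ - fstar j ξ }

instance matMeasurableSpace (n : ℕ) : MeasurableSpace (Matrix (Fin n) (Fin n) ℝ) :=
  (inferInstance : MeasurableSpace (Fin n → Fin n → ℝ))

/-- A measure on the space of `n×n` real matrices has finite first moment if each entry
is integrable. -/
def FiniteFirstMoment {n : ℕ} (ν : Measure (Matrix (Fin n) (Fin n) ℝ)) : Prop :=
  ∀ i j : Fin n, Integrable (fun s : Matrix (Fin n) (Fin n) ℝ => s i j) ν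

/-- The barycenter `[ν] = ∫ s dν(s)` of a measure on matrices, computed entrywise. -/
def bary {n : ℕ} (ν : Measure (Matrix (Fin n) (Fin n) ℝ)) : Matrix (Fin n) (Fin n) ℝ :=
  Matrix.of fun i j => ∫ s, s i j ∂ν

/-- The set of values `∫ j* dν` over Borel probability measures `ν` on `Sym_n` supported
in `G_k` (symmetric matrices of rank ≤ k), with finite first moment and barycenter `ξ`. -/
def gkSet {n : ℕ} (j : Matrix (Fin n) (Fin n) ℝ → ℝ) (k : ℕ)
    (ξ : Matrix (Fin n) (Fin n) ℝ) : Set ℝ :=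
  { r : ℝ | ∃ ν : Measure (Matrix (Fin n) (Fin n) ℝ), IsProbabilityMeasure ν ∧
      ν {s : Matrix (Fin n) (Fin n) ℝ | ¬ (s.IsSymm ∧ s.rank ≤ k)} = 0 ∧
      FiniteFirstMoment ν ∧ bary ν = ξ ∧
      Integrable (fstar j) ν ∧ r = ∫ s, fstar j s ∂ν }

/-- `g_k(ξ) = inf { ∫ j* dν : ν probability on Sym_n, spt ν ⊆ G_k, [ν] = ξ }`. -/
def gk {n : ℕ} (j : Matrix (Fin n) (Fin n) ℝ → ℝ) (k : ℕ)
    (ξ : Matrix (Fin n) (Fin n) ℝ) : ℝ :=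
  sInf (gkSet j k ξ)

/-- Symmetric matrices as a submodule. -/
def symmSubmodule (n : ℕ) : Submodule ℝ (Matrix (Fin n) (Fin n) ℝ) where
  carrier := {z | z.IsSymm}
  add_mem' := fun ha hb => ha.add hb
  zero_mem' := Matrix.isSymm_zero
  smul_mem' := fun c _ hx => hx.smul c

/-- A positive definite quadratic form on a finite-dimensional real space, minus a linear form,
is bounded below. -/
lemma QuadraticForm.bddAbove_dual_sub {V : Type*} [AddCommGroup V] [Module ℝ V]
    [FiniteDimensional ℝ V] (Q : QuadraticForm ℝ V) (hQ : ∀ v, v ≠ 0 → 0 < Q v)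
    (f : Module.Dual ℝ V) : ∃ M, ∀ v, f v - Q v ≤ M := by
  have hinj : Function.Injective (QuadraticMap.polarBilin Q : V →ₗ[ℝ] Module.Dual ℝ V) := by
    rw [injective_iff_map_eq_zero]
    intro v hv
    by_contra hne
    have h : QuadraticMap.polar Q v v = 0 := by
      simpa using LinearMap.congr_fun hv v
    rw [QuadraticMap.polar_self] at h
    have := hQ v hne
    simp at h
    linarith
  have hsurj := (LinearMap.injective_iff_surjective_of_finrank_eq_finrank
    (Subspace.dual_finrank_eq (K := ℝ) (V := V)).symm).1 hinj
  obtain ⟨w, hw⟩ := hsurj f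
  refine ⟨Q w, fun v => ?_⟩
  have h1 : f v = Q (w + v) - Q w - Q v := by
    rw [← hw]; rfl
  have h2 : f v = - (Q (w - v) - Q w - Q v) := by
    have h3 : f (-v) = Q (w + -v) - Q w - Q (-v) := by rw [← hw]; rfl
    rw [map_neg, QuadraticMap.map_neg, ← sub_eq_add_neg] at h3
    linarith
  have h4 : 0 ≤ Q (w - v) := by
    by_cases h : w - v = 0
    · simp [h]
    · exact (hQ _ h).le
  linarith

lemma mdot_zero_right {n : ℕ} (z : Matrix (Fin n) (Fin n) ℝ) : mdot z 0 = 0 := by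
  simp [mdot]

lemma mdot_zero_left {n : ℕ} (z : Matrix (Fin n) (Fin n) ℝ) : mdot 0 z = 0 := by
  simp [mdot]

lemma mdot_self_pos {n : ℕ} {z : Matrix (Fin n) (Fin n) ℝ} (hz : z.IsSymm) (h0 : z ≠ 0) :
    0 < mdot z z := by
  have h : mdot z z = ∑ i, ∑ j, z i j ^ 2 := by
    simp only [mdot, Matrix.trace, Matrix.diag, Matrix.mul_apply]
    refine Finset.sum_congr rfl fun i _ => Finset.sum_congr rfl fun j _ => ?_
    rw [hz.apply i j, sq]
  have hnn : 0 ≤ mdot z z := by rw [h]; positivity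
  refine lt_of_le_of_ne hnn fun h1 => h0 ?_
  rw [h, eq_comm, Finset.sum_eq_zero_iff_of_nonneg (fun i _ => by positivity)] at h1
  ext i j
  have h2 := h1 i (Finset.mem_univ i)
  rw [Finset.sum_eq_zero_iff_of_nonneg (fun i _ => by positivity)] at h2
  simpa using h2 j (Finset.mem_univ j)

lemma integrable_mdot {n : ℕ} (z : Matrix (Fin n) (Fin n) ℝ)
    {ν : Measure (Matrix (Fin n) (Fin n) ℝ)} (hν : FiniteFirstMoment ν) :
    Integrable (fun s => mdot z s) ν := by
  simp only [mdot, Matrix.trace, Matrix.diag, Matrix.mul_apply]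
  exact integrable_finsetSum _ fun i _ => integrable_finsetSum _ fun l _ => (hν l i).const_mul _

lemma integral_mdot {n : ℕ} (z : Matrix (Fin n) (Fin n) ℝ)
    {ν : Measure (Matrix (Fin n) (Fin n) ℝ)} (hν : FiniteFirstMoment ν) :
    ∫ s, mdot z s ∂ν = mdot z (bary ν) := by
  simp only [mdot, Matrix.trace, Matrix.diag, Matrix.mul_apply, bary, Matrix.of_apply]
  refine (integral_finsetSum _ fun i _ =>
    integrable_finsetSum _ fun l _ => (hν l i).const_mul _).trans ?_
  refine Finset.sum_congr rfl fun i _ => ?_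
  refine (integral_finsetSum _ fun l _ => (hν l i).const_mul _).trans ?_
  exact Finset.sum_congr rfl fun l _ => integral_const_mul _ _

instance matMeasurableSingletonClass (n : ℕ) :
    MeasurableSingletonClass (Matrix (Fin n) (Fin n) ℝ) :=
  inferInstanceAs (MeasurableSingletonClass (Fin n → Fin n → ℝ))

lemma Matrix.eq_zero_of_rank_eq_zero {m n : Type*} [Fintype n] [Fintype m] {A : Matrix m n ℝ}
    (h : A.rank = 0) : A = 0 := by
  classical
  rw [Matrix.rank, Submodule.finrank_eq_zero, LinearMap.range_eq_bot] at h
  refine Matrix.ext_of_mulVec_single fun i => ?_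
  rw [← Matrix.mulVecLin_apply, h, Matrix.zero_mulVec, LinearMap.zero_apply]

/-- A Dirac mass is admissible at a matrix of `G_k`. -/
lemma fstar_mem_gkSet {n : ℕ} (j : Matrix (Fin n) (Fin n) ℝ → ℝ) {k : ℕ}
    {ξ : Matrix (Fin n) (Fin n) ℝ} (hs : ξ.IsSymm) (hr : ξ.rank ≤ k) :
    fstar j ξ ∈ gkSet j k ξ := by
  refine ⟨Measure.dirac ξ, inferInstance, ?_, fun i l => integrable_dirac (by simp), ?_,
    integrable_dirac (by simp), ?_⟩
  · rw [Measure.dirac_apply]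
    simp [hs, hr]
  · ext i l
    simp [bary, integral_dirac]
  · rw [integral_dirac]

/-- A sum of matrices of `G_k` is the barycenter of an admissible measure. -/
lemma gkSet_sum_nonempty {n : ℕ} (hn : 1 ≤ n) (j : Matrix (Fin n) (Fin n) ℝ → ℝ) {k : ℕ}
    (A : Fin n → Matrix (Fin n) (Fin n) ℝ) (hs : ∀ i, (A i).IsSymm) (hr : ∀ i, (A i).rank ≤ k) :
    (gkSet j k (∑ i, A i)).Nonempty := by
  have hn0 : (n : ℝ) ≠ 0 := by positivity
  let ν : Measure (Matrix (Fin n) (Fin n) ℝ) :=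
    ∑ i, (n : ENNReal)⁻¹ • Measure.dirac ((n : ℝ) • A i)
  have hint : ∀ f : Matrix (Fin n) (Fin n) ℝ → ℝ, ∀ i ∈ Finset.univ,
      Integrable f ((n : ENNReal)⁻¹ • Measure.dirac ((n : ℝ) • A i)) := fun f i _ =>
    (integrable_dirac (by simp)).smul_measure (by simp; omega)
  refine ⟨_, ν, ⟨?_⟩, ?_, fun i l => integrable_finsetSum_measure.2 (hint _), ?_,
    integrable_finsetSum_measure.2 (hint _), rfl⟩
  · simp only [ν, Measure.finsetSum_apply, Measure.smul_apply, measure_univ, smul_eq_mul, mul_one,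
      Finset.sum_const, Finset.card_univ, Fintype.card_fin, nsmul_eq_mul]
    exact ENNReal.mul_inv_cancel (by simp; omega) (by simp)
  · simp only [ν, Measure.finsetSum_apply, Measure.smul_apply, smul_eq_mul]
    refine Finset.sum_eq_zero fun i _ => ?_
    rw [Measure.dirac_apply]
    simp [(hs i).smul (n : ℝ),
      (Matrix.rank_smul_of_mem_nonZeroDivisors (A i)
      (mem_nonZeroDivisors_of_ne_zero hn0)).trans_le (hr i)]
  · ext a b
    simp only [bary, Matrix.of_apply, ν]
    rw [integral_finsetSum_measure (hint _), Matrix.sum_apply]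
    refine Finset.sum_congr rfl fun i _ => ?_
    rw [integral_smul_measure, integral_dirac]
    simp [hn0]

/-- A real symmetric matrix is a sum of symmetric matrices of rank at most one. -/
lemma Matrix.IsSymm.exists_eq_sum_rank_le_one {n : ℕ} {ξ : Matrix (Fin n) (Fin n) ℝ}
    (hξ : ξ.IsSymm) : ∃ A : Fin n → Matrix (Fin n) (Fin n) ℝ,
      (∀ i, (A i).IsSymm) ∧ (∀ i, (A i).rank ≤ 1) ∧ ∑ i, A i = ξ := by
  have hH : ξ.IsHermitian := by
    rw [Matrix.IsHermitian, Matrix.conjTranspose_eq_transpose_of_trivial]; exact hξ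
  let U : Matrix (Fin n) (Fin n) ℝ := hH.eigenvectorUnitary
  refine ⟨fun i => Matrix.vecMulVec (hH.eigenvalues i • U.col i) (U.col i), fun i => ?_,
    fun i => Matrix.rank_vecMulVec_le _ _, ?_⟩
  · ext a b
    simp [Matrix.vecMulVec_apply]
    ring
  · conv_rhs => rw [hH.spectral_theorem]
    ext a b
    simp [Matrix.sum_apply, Matrix.vecMulVec_apply, Unitary.conjStarAlgAut_apply,
      Matrix.mul_apply, Matrix.diagonal_apply, U]
    exact Finset.sum_congr rfl fun i _ => by ring

/-- for every `0 ≤ k ≤ n`, the Fenchel conjugate of `g_k` equals `j_k`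
on `Sym_n`. -/
theorem gkstar_eq_jk (n : ℕ) (hn : 1 ≤ n) (j : Matrix (Fin n) (Fin n) ℝ → ℝ)
    (hquad : ∃ Q : QuadraticForm ℝ (Matrix (Fin n) (Fin n) ℝ),
      ∀ z : Matrix (Fin n) (Fin n) ℝ, z.IsSymm → j z = Q z)
    (hpos : ∀ z : Matrix (Fin n) (Fin n) ℝ, z.IsSymm → z ≠ 0 → 0 < j z)
    (k : ℕ) (hk : k ≤ n) :
    ∀ z : Matrix (Fin n) (Fin n) ℝ, z.IsSymm →
      fstar (gk j k) z = jk j k z := by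
  obtain ⟨Q, hQ⟩ := hquad
  have hj0 : j 0 = 0 := by rw [hQ 0 Matrix.isSymm_zero, map_zero]
  have hjnn : ∀ z : Matrix (Fin n) (Fin n) ℝ, z.IsSymm → 0 ≤ j z := fun z hz => by
    by_cases h : z = 0
    · rw [h, hj0]
    · exact (hpos z hz h).le
  have hbdd : ∀ ξ : Matrix (Fin n) (Fin n) ℝ, BddAbove
      { r : ℝ | ∃ z : Matrix (Fin n) (Fin n) ℝ, z.IsSymm ∧ r = mdot z ξ - j z } := fun ξ => by
    let f : Module.Dual ℝ (symmSubmodule n) :=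
      (Matrix.traceLinearMap (Fin n) ℝ ℝ ∘ₗ LinearMap.mulRight ℝ ξ).domRestrict _
    obtain ⟨M, hM⟩ := QuadraticForm.bddAbove_dual_sub (Q.comp (symmSubmodule n).subtype)
      (fun v hv => by
        have := hpos v.1 v.2 (by simpa using hv)
        rwa [hQ v.1 v.2] at this) f
    refine ⟨M, ?_⟩
    rintro r ⟨z, hz, rfl⟩
    rw [hQ z hz]
    exact hM ⟨z, hz⟩
  have hyoung : ∀ z ξ : Matrix (Fin n) (Fin n) ℝ, z.IsSymm → mdot z ξ - j z ≤ fstar j ξ :=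
    fun z ξ hz => le_csSup (hbdd ξ) ⟨z, hz, rfl⟩
  have hnn : ∀ ξ, 0 ≤ fstar j ξ := fun ξ => by
    simpa [hj0, mdot_zero_left] using hyoung 0 ξ Matrix.isSymm_zero
  have hstar0 : fstar j 0 = 0 := by
    refine le_antisymm (csSup_le ⟨_, 0, Matrix.isSymm_zero, rfl⟩ ?_) (hnn 0)
    rintro r ⟨z, hz, rfl⟩
    rw [mdot_zero_right]
    linarith [hjnn z hz]
  intro z hz
  rcases Nat.eq_zero_or_pos k with rfl | hk1
  · have hrank : ∀ ξ : Matrix (Fin n) (Fin n) ℝ, ξ.rank ≤ 0 → ξ = 0 := fun ξ h =>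
      Matrix.eq_zero_of_rank_eq_zero (Nat.le_zero.1 h)
    have hgk : ∀ ξ, gk j 0 ξ = 0 := fun ξ => by
      have hsub : gkSet j 0 ξ ⊆ {0} := by
        rintro r ⟨ν, _, hsupp, -, -, -, rfl⟩
        have hae : ∀ᵐ s ∂ν, s.IsSymm ∧ s.rank ≤ 0 := hsupp
        refine integral_eq_zero_of_ae (hae.mono fun s hs => ?_)
        rw [hrank s hs.2]
        exact hstar0
      rcases Set.subset_singleton_iff_eq.1 hsub with h | h <;> simp [gk, h]
    have hjk : jk j 0 z = 0 := by
      have : { r : ℝ | ∃ ξ : Matrix (Fin n) (Fin n) ℝ, ξ.IsSymm ∧ ξ.rank ≤ 0 ∧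
          r = mdot z ξ - fstar j ξ } = {0} := by
        ext r
        constructor
        · rintro ⟨ξ, -, hr, rfl⟩
          simp [hrank ξ hr, mdot_zero_right, hstar0]
        · rintro rfl
          exact ⟨0, Matrix.isSymm_zero, by simp, by simp [mdot_zero_right, hstar0]⟩
      rw [jk, this, csSup_singleton]
    rw [hjk, fstar]
    simp only [hgk, sub_zero]
    by_cases h0 : z = 0
    · subst h0
      have hm : ∀ z' : Matrix (Fin n) (Fin n) ℝ, mdot z' 0 = 0 := mdot_zero_right
      have : { r : ℝ | ∃ ξ : Matrix (Fin n) (Fin n) ℝ, ξ.IsSymm ∧ r = mdot ξ 0 } = {0} := by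
        ext r
        simp only [hm]
        exact ⟨fun ⟨_, _, h⟩ => h, fun h => ⟨0, Matrix.isSymm_zero, h⟩⟩
      simp [this]
    · apply Real.sSup_of_not_bddAbove
      rintro ⟨M, hM⟩
      have hp := mdot_self_pos hz h0
      have h1 : mdot (((M + 1) / mdot z z) • z) z ≤ M :=
        hM ⟨((M + 1) / mdot z z) • z, hz.smul _, rfl⟩
      have h2 : mdot (((M + 1) / mdot z z) • z) z = (M + 1) / mdot z z * mdot z z := by
        simp [mdot]
      rw [h2, div_mul_cancel₀ _ hp.ne'] at h1
      linarith
  · have hcomm : ∀ a b : Matrix (Fin n) (Fin n) ℝ, mdot a b = mdot b a := fun a b =>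
      Matrix.trace_mul_comm a b
    have hjkbdd : BddAbove { r : ℝ | ∃ ξ : Matrix (Fin n) (Fin n) ℝ, ξ.IsSymm ∧ ξ.rank ≤ k ∧
        r = mdot z ξ - fstar j ξ } := by
      refine ⟨j z, ?_⟩
      rintro r ⟨ξ, -, -, rfl⟩
      linarith [hyoung z ξ hz]
    have hne : ∀ ξ : Matrix (Fin n) (Fin n) ℝ, ξ.IsSymm → (gkSet j k ξ).Nonempty := fun ξ hξ => by
      obtain ⟨A, hs, hr, rfl⟩ := hξ.exists_eq_sum_rank_le_one
      exact gkSet_sum_nonempty hn j A hs fun i => (hr i).trans hk1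
    have hbelow : ∀ ξ, BddBelow (gkSet j k ξ) := fun ξ => by
      refine ⟨0, ?_⟩
      rintro r ⟨ν, _, -, -, -, -, rfl⟩
      exact integral_nonneg hnn
    have hle : ∀ ξ : Matrix (Fin n) (Fin n) ℝ, ξ.IsSymm → mdot ξ z - gk j k ξ ≤ jk j k z := by
      intro ξ hξ
      suffices h : mdot z ξ - jk j k z ≤ gk j k ξ by rw [hcomm]; linarith
      refine le_csInf (hne ξ hξ) ?_
      rintro r ⟨ν, _, hsupp, hfm, rfl, hint, rfl⟩
      have hae : ∀ᵐ s ∂ν, s.IsSymm ∧ s.rank ≤ k := hsupp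
      have h1 : ∫ s, (mdot z s - jk j k z) ∂ν ≤ ∫ s, fstar j s ∂ν := by
        refine integral_mono_ae ((integrable_mdot z hfm).sub (integrable_const _)) hint
          (hae.mono fun s hs => ?_)
        have : mdot z s - fstar j s ≤ jk j k z := le_csSup hjkbdd ⟨s, hs.1, hs.2, rfl⟩
        show mdot z s - jk j k z ≤ fstar j s
        linarith
      rw [integral_sub (integrable_mdot z hfm) (integrable_const _), integral_mdot z hfm] at h1
      simpa using h1
    refine le_antisymm (csSup_le ⟨_, 0, Matrix.isSymm_zero, rfl⟩ ?_)
      (csSup_le ⟨_, 0, Matrix.isSymm_zero, by simp, rfl⟩ ?_)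
    · rintro r ⟨ξ, hξ, rfl⟩
      exact hle ξ hξ
    · rintro r ⟨ξ, hξ, hr, rfl⟩
      have h1 : gk j k ξ ≤ fstar j ξ := csInf_le (hbelow ξ) (fstar_mem_gkSet j hξ hr)
      have h2 : mdot ξ z - gk j k ξ ≤ fstar (gk j k) z := by
        refine le_csSup ⟨jk j k z, ?_⟩ ⟨ξ, hξ, rfl⟩
        rintro r ⟨ξ', hξ', rfl⟩
        exact hle ξ' hξ'
      rw [hcomm]
      linarith
end
end

section
/- Let n = 2 and let α, β ∈ ℝ satisfy β > 0 and α + β > 0. Define j(z) = (α/2)(tr z)² + β‖z‖² on Sym_2 (Frobenius norm), and set γ = (α + 2β)/(4β(α + β)). Then for every ξ ∈ Sym_2, the Fenchel conjugate of \bar j := j_1 satisfies (\bar j)*(ξ) = (γ/2)(|τ₁(ξ)| + |τ₂(ξ)|)², where τ₁(ξ), τ₂(ξ) are the eigenvalues of ξ. -/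
open MeasureTheory

noncomputable section

/-- The quadratic form `(a/2)(tr w)² + b‖w‖²` on `2×2` matrices. -/
def isoQuad (a b : ℝ) (w : Matrix (Fin 2) (Fin 2) ℝ) : ℝ :=
  (a / 2) * (Matrix.trace w) ^ 2 + b * ∑ i, ∑ j', (w i j') ^ 2

/-- The constant `γ = (a + 2b)/(4b(a + b))`. -/
def isoGamma (a b : ℝ) : ℝ := (a + 2 * b) / (4 * b * (a + b))

lemma isoGamma_pos {a b : ℝ} (hb : 0 < b) (hab : 0 < a + b) : 0 < isoGamma a b := by
  unfold isoGamma
  have : 0 < a + 2 * b := by linarith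
  positivity

lemma Matrix.det_eq_zero_of_rank_le_one {ξ : Matrix (Fin 2) (Fin 2) ℝ} (h : ξ.rank ≤ 1) :
    ξ.det = 0 := by
  by_contra hd
  have := Matrix.rank_of_isUnit ξ ((Matrix.isUnit_iff_isUnit_det ξ).2 (isUnit_iff_ne_zero.2 hd))
  simp at this
  omega

/-- On symmetric singular matrices the conjugate of `isoQuad` is a maximum, with value
`(γ/2)(tr ξ)²`. -/
lemma isGreatest_isoQuad_conj {a b : ℝ} (hb : 0 < b) (hab : 0 < a + b)
    {ξ : Matrix (Fin 2) (Fin 2) ℝ} (hs : ξ.IsSymm) (hd : ξ.det = 0) :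
    IsGreatest { r : ℝ | ∃ z : Matrix (Fin 2) (Fin 2) ℝ, z.IsSymm ∧ r = mdot z ξ - isoQuad a b z }
      (isoGamma a b / 2 * ξ.trace ^ 2) := by
  have h10 : ξ 1 0 = ξ 0 1 := hs.apply 0 1
  rw [Matrix.det_fin_two, h10] at hd
  set p := ξ 0 0
  set q := ξ 0 1
  set r := ξ 1 1
  have hval : isoGamma a b / 2 * ξ.trace ^ 2
      = (p + r) ^ 2 / (8 * (a + b)) + ((p - r) ^ 2 / 2 + 2 * q ^ 2) / (4 * b) := by
    have hq : 2 * q ^ 2 = 2 * (p * r) := by linarith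
    rw [hq, Matrix.trace_fin_two, isoGamma]
    field_simp
    ring
  rw [hval]
  constructor
  · refine ⟨!![(p + r) / (4 * (a + b)) + (p - r) / (4 * b), q / (2 * b);
      q / (2 * b), (p + r) / (4 * (a + b)) - (p - r) / (4 * b)], ?_, ?_⟩
    · ext i k
      fin_cases i <;> fin_cases k <;> rfl
    · simp only [mdot, isoQuad, Matrix.trace_fin_two, Matrix.mul_apply, Fin.sum_univ_two, h10,
        Matrix.of_apply, Matrix.cons_val', Matrix.cons_val_zero, Matrix.cons_val_one,
        Matrix.cons_val_fin_one]
      change _ = _ * p + _ * q + (_ * q + _ * r) - _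
      field_simp
      ring
  · rintro x ⟨z, hz, rfl⟩
    have hz10 : z 1 0 = z 0 1 := hz.apply 0 1
    have key : (p + r) ^ 2 / (8 * (a + b)) + ((p - r) ^ 2 / 2 + 2 * q ^ 2) / (4 * b)
        - (mdot z ξ - isoQuad a b z)
        = (a + b) / 2 * (z 0 0 + z 1 1 - (p + r) / (2 * (a + b))) ^ 2
          + b / 2 * (z 0 0 - z 1 1 - (p - r) / (2 * b)) ^ 2
          + 2 * b * (z 0 1 - q / (2 * b)) ^ 2 := by
      simp only [mdot, isoQuad, Matrix.trace_fin_two, Matrix.mul_apply, Fin.sum_univ_two, h10,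
        hz10]
      change _ - (_ * p + _ * q + (_ * q + _ * r) - _) = _
      field_simp
      ring
    have : 0 ≤ (a + b) / 2 * (z 0 0 + z 1 1 - (p + r) / (2 * (a + b))) ^ 2
          + b / 2 * (z 0 0 - z 1 1 - (p - r) / (2 * b)) ^ 2
          + 2 * b * (z 0 1 - q / (2 * b)) ^ 2 := by positivity
    linarith

lemma fstar_isoQuad {a b : ℝ} (hb : 0 < b) (hab : 0 < a + b)
    {ξ : Matrix (Fin 2) (Fin 2) ℝ} (hs : ξ.IsSymm) (hd : ξ.det = 0) :
    fstar (isoQuad a b) ξ = isoGamma a b / 2 * ξ.trace ^ 2 :=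
  (isGreatest_isoQuad_conj hb hab hs hd).csSup_eq

lemma le_jk_isoQuad {a b : ℝ} (hb : 0 < b) (hab : 0 < a + b)
    {z ξ : Matrix (Fin 2) (Fin 2) ℝ} (hz : z.IsSymm) (hs : ξ.IsSymm) (hr : ξ.rank ≤ 1) :
    mdot z ξ - isoGamma a b / 2 * ξ.trace ^ 2 ≤ jk (isoQuad a b) 1 z := by
  refine le_csSup ⟨isoQuad a b z, ?_⟩ ⟨ξ, hs, hr, ?_⟩
  · rintro x ⟨η, hη, hηr, rfl⟩
    have hd := Matrix.det_eq_zero_of_rank_le_one hηr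
    have := (isGreatest_isoQuad_conj hb hab hη hd).2 ⟨z, hz, rfl⟩
    rw [fstar_isoQuad hb hab hη hd]
    linarith
  · rw [fstar_isoQuad hb hab hs (Matrix.det_eq_zero_of_rank_le_one hr)]

/-- Testing `j_1` against multiples of the projection onto a unit vector `v`. -/
lemma abs_quadForm_le_jk_isoQuad {a b : ℝ} (hb : 0 < b) (hab : 0 < a + b)
    {z : Matrix (Fin 2) (Fin 2) ℝ} (hz : z.IsSymm) {v : Fin 2 → ℝ}
    (hv : v 0 ^ 2 + v 1 ^ 2 = 1) (t : ℝ) :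
    t * |v ⬝ᵥ z.mulVec v| - isoGamma a b / 2 * t ^ 2 ≤ jk (isoQuad a b) 1 z := by
  have main (c : ℝ) :
      c * (v ⬝ᵥ z.mulVec v) - isoGamma a b / 2 * c ^ 2 ≤ jk (isoQuad a b) 1 z := by
    have hs : (Matrix.vecMulVec (c • v) v).IsSymm := by
      ext i k
      simp only [Matrix.transpose_apply, Matrix.vecMulVec_apply, Pi.smul_apply, smul_eq_mul]
      ring
    have h := le_jk_isoQuad hb hab hz hs (Matrix.rank_vecMulVec_le _ _)
    have htr : (Matrix.vecMulVec (c • v) v).trace = c := by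
      simp only [Matrix.trace_fin_two, Matrix.vecMulVec_apply, Pi.smul_apply, smul_eq_mul]
      linear_combination c * hv
    have hm : mdot z (Matrix.vecMulVec (c • v) v) = c * (v ⬝ᵥ z.mulVec v) := by
      simp only [mdot, Matrix.trace_fin_two, Matrix.mul_apply, Fin.sum_univ_two,
        Matrix.vecMulVec_apply, Pi.smul_apply, smul_eq_mul, dotProduct, Matrix.mulVec]
      ring
    rwa [htr, hm] at h
  rcases abs_cases (v ⬝ᵥ z.mulVec v) with ⟨h, -⟩ | ⟨h, -⟩ <;> rw [h]
  · exact main t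
  · have := main (-t)
    linarith [neg_sq t, mul_neg t (v ⬝ᵥ z.mulVec v), neg_mul t (v ⬝ᵥ z.mulVec v),
      congrArg (isoGamma a b / 2 * ·) (neg_sq t)]

/-- A symmetric singular `η` pairs with an orthogonally diagonalized matrix with eigenvalues in
`[-c, c]` to at most `c |tr η|`. -/
lemma mdot_le_of_abs_eigenvalues_le {P η : Matrix (Fin 2) (Fin 2) ℝ} {σ : Fin 2 → ℝ} {c : ℝ}
    (hP : P * P.transpose = 1) (hσ : ∀ i, |σ i| ≤ c) (hs : η.IsSymm) (hd : η.det = 0) :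
    mdot (P * Matrix.diagonal σ * P.transpose) η ≤ c * |η.trace| := by
  set ζ := P.transpose * η * P with hζ
  have hζs : ζ.IsSymm := by
    simp only [hζ, Matrix.IsSymm, Matrix.transpose_mul, Matrix.transpose_transpose, hs.eq,
      Matrix.mul_assoc]
  have hζd : ζ.det = 0 := by simp [hζ, hd]
  have hζt : ζ.trace = η.trace := by
    rw [hζ, Matrix.mul_assoc, Matrix.trace_mul_comm, Matrix.mul_assoc, hP, Matrix.mul_one]
  have hm : mdot (P * Matrix.diagonal σ * P.transpose) η = σ 0 * ζ 0 0 + σ 1 * ζ 1 1 := by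
    have : mdot (P * Matrix.diagonal σ * P.transpose) η = (Matrix.diagonal σ * ζ).trace := by
      rw [mdot, hζ, Matrix.mul_assoc, Matrix.mul_assoc, Matrix.trace_mul_comm]
      simp only [Matrix.mul_assoc]
    rw [this, Matrix.trace_fin_two, Matrix.diagonal_mul, Matrix.diagonal_mul]
  have hprod : 0 ≤ ζ 0 0 * ζ 1 1 := by
    have h10 : ζ 1 0 = ζ 0 1 := hζs.apply 0 1
    rw [Matrix.det_fin_two, h10] at hζd
    nlinarith [sq_nonneg (ζ 0 1)]
  have habs : |ζ 0 0| + |ζ 1 1| = |η.trace| := by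
    rw [← hζt, Matrix.trace_fin_two]
    exact ((abs_add_eq_add_abs_iff _ _).2 (mul_nonneg_iff.1 hprod)).symm
  have bound (i : Fin 2) : σ i * ζ i i ≤ c * |ζ i i| :=
    (le_abs_self _).trans (by
      rw [abs_mul]
      exact mul_le_mul_of_nonneg_right (hσ i) (abs_nonneg _))
  rw [hm, ← habs, mul_add]
  exact add_le_add (bound 0) (bound 1)

lemma jk_isoQuad_le {a b : ℝ} (hb : 0 < b) (hab : 0 < a + b) {P : Matrix (Fin 2) (Fin 2) ℝ}
    {σ : Fin 2 → ℝ} {t : ℝ} (hP : P * P.transpose = 1) (hσ : ∀ i, |σ i| ≤ isoGamma a b * t) :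
    jk (isoQuad a b) 1 (P * Matrix.diagonal σ * P.transpose) ≤ isoGamma a b / 2 * t ^ 2 := by
  refine csSup_le ⟨_, 0, Matrix.transpose_zero, by simp, rfl⟩ ?_
  rintro x ⟨η, hη, hηr, rfl⟩
  have hd := Matrix.det_eq_zero_of_rank_le_one hηr
  rw [fstar_isoQuad hb hab hη hd, ← sq_abs η.trace]
  have h := mdot_le_of_abs_eigenvalues_le hP hσ hη hd
  nlinarith [mul_nonneg (isoGamma_pos hb hab).le (sq_nonneg (t - |η.trace|))]

lemma mdot_orthogonal_diagonal (z P : Matrix (Fin 2) (Fin 2) ℝ) (τ : Fin 2 → ℝ) :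
    mdot z (P * Matrix.diagonal τ * P.transpose)
      = τ 0 * (P.col 0 ⬝ᵥ z.mulVec (P.col 0)) + τ 1 * (P.col 1 ⬝ᵥ z.mulVec (P.col 1)) := by
  simp only [mdot, Matrix.trace_fin_two, Matrix.mul_apply, Fin.sum_univ_two,
    Matrix.diagonal_apply_eq, Matrix.diagonal_apply_ne _ (zero_ne_one (α := Fin 2)),
    Matrix.diagonal_apply_ne _ (one_ne_zero (α := Fin 2)),
    Matrix.transpose_apply, dotProduct, Matrix.mulVec, Matrix.col_apply]
  ring

lemma mdot_diagonal_diagonal {P : Matrix (Fin 2) (Fin 2) ℝ} (hP : P * P.transpose = 1)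
    (σ τ : Fin 2 → ℝ) :
    mdot (P * Matrix.diagonal σ * P.transpose) (P * Matrix.diagonal τ * P.transpose)
      = σ 0 * τ 0 + σ 1 * τ 1 := by
  have hP' : P.transpose * P = 1 := mul_eq_one_comm.1 hP
  have : P * Matrix.diagonal σ * P.transpose * (P * Matrix.diagonal τ * P.transpose)
      = P * (Matrix.diagonal σ * Matrix.diagonal τ) * P.transpose := by
    calc _ = P * Matrix.diagonal σ * (P.transpose * P) * Matrix.diagonal τ * P.transpose := by
          simp only [Matrix.mul_assoc]
      _ = _ := by rw [hP', Matrix.mul_one, Matrix.mul_assoc P]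
  rw [mdot, this, Matrix.trace_mul_comm, ← Matrix.mul_assoc, hP', Matrix.one_mul,
    Matrix.diagonal_mul_diagonal, Matrix.trace_fin_two, Matrix.diagonal_apply_eq,
    Matrix.diagonal_apply_eq]

/-- for `n = 2`, `β > 0`, `α + β > 0`, `j(z) = (α/2)(tr z)² + β‖z‖²`
(Frobenius norm) and `γ = (α + 2β)/(4β(α + β))`, for every symmetric `ξ` with
eigenvalues `τ 0, τ 1` (given by an orthogonal diagonalization), the Fenchel
conjugate of `\bar j := j_1` satisfies `(\bar j)*(ξ) = (γ/2)(|τ 0| + |τ 1|)²`. -/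
theorem jbarstar_eq_dim2 (a b : ℝ) (hb : 0 < b) (hab : 0 < a + b)
    (ξ P : Matrix (Fin 2) (Fin 2) ℝ) (τ : Fin 2 → ℝ)
    (hP : P * P.transpose = 1) (hξ : ξ = P * Matrix.diagonal τ * P.transpose) :
    fstar (jk (fun w : Matrix (Fin 2) (Fin 2) ℝ =>
        (a / 2) * (Matrix.trace w) ^ 2 + b * ∑ i, ∑ j', (w i j') ^ 2) 1) ξ
      = (((a + 2 * b) / (4 * b * (a + b))) / 2) * (|τ 0| + |τ 1|) ^ 2 := by
  change fstar (jk (isoQuad a b) 1) ξ = isoGamma a b / 2 * (|τ 0| + |τ 1|) ^ 2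
  have hγ := isoGamma_pos hb hab
  set t := |τ 0| + |τ 1| with ht
  have ht0 : 0 ≤ t := by positivity
  have upper (z : Matrix (Fin 2) (Fin 2) ℝ) (hz : z.IsSymm) :
      mdot z ξ - jk (isoQuad a b) 1 z ≤ isoGamma a b / 2 * t ^ 2 := by
    have hP' : P.transpose * P = 1 := mul_eq_one_comm.1 hP
    have hv (i : Fin 2) : P.col i 0 ^ 2 + P.col i 1 ^ 2 = 1 := by
      have := congrFun (congrFun hP' i) i
      simpa [Matrix.mul_apply, Fin.sum_univ_two, sq] using this
    have key (i : Fin 2) := abs_quadForm_le_jk_isoQuad hb hab hz (hv i) t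
    have hJ : 0 ≤ jk (isoQuad a b) 1 z := by
      simpa using abs_quadForm_le_jk_isoQuad hb hab hz (hv 0) 0
    rw [hξ, mdot_orthogonal_diagonal]
    have h0 := key 0
    have h1 := key 1
    set m₀ := P.col 0 ⬝ᵥ z.mulVec (P.col 0)
    set m₁ := P.col 1 ⬝ᵥ z.mulVec (P.col 1)
    set J := jk (isoQuad a b) 1 z
    have hs : τ 0 * m₀ + τ 1 * m₁ ≤ |τ 0| * |m₀| + |τ 1| * |m₁| := by
      rw [← abs_mul, ← abs_mul]
      exact add_le_add (le_abs_self _) (le_abs_self _)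
    rcases ht0.eq_or_lt with h | hpos
    · have e0 : |τ 0| = 0 := by linarith [abs_nonneg (τ 0), abs_nonneg (τ 1)]
      have e1 : |τ 1| = 0 := by linarith [abs_nonneg (τ 0), abs_nonneg (τ 1)]
      rw [e0, e1] at hs
      have : 0 ≤ isoGamma a b / 2 * t ^ 2 := by positivity
      linarith
    · have hmul : t * (|τ 0| * |m₀| + |τ 1| * |m₁|) ≤ t * (J + isoGamma a b / 2 * t ^ 2) := by
        have k0 := mul_le_mul_of_nonneg_left h0 (abs_nonneg (τ 0))
        have k1 := mul_le_mul_of_nonneg_left h1 (abs_nonneg (τ 1))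
        have ht' : t * (J + isoGamma a b / 2 * t ^ 2) =
          |τ 0| * (J + isoGamma a b / 2 * t ^ 2) + |τ 1| * (J + isoGamma a b / 2 * t ^ 2) := by
          rw [← add_mul]
        rw [ht']
        linarith
      have := le_of_mul_le_mul_left hmul hpos
      linarith
  refine IsGreatest.csSup_eq ⟨?_, ?_⟩
  · let σ : Fin 2 → ℝ := fun i => isoGamma a b * t * SignType.sign (τ i)
    have hσ (i : Fin 2) : |σ i| ≤ isoGamma a b * t := by
      have h1 : |((SignType.sign (τ i) : SignType) : ℝ)| ≤ 1 := by
        rcases SignType.sign (τ i) with _ | _ | _ <;> simp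
      rw [abs_mul, abs_of_nonneg (by positivity : 0 ≤ isoGamma a b * t)]
      exact mul_le_of_le_one_right (by positivity) h1
    have hz : (P * Matrix.diagonal σ * P.transpose).IsSymm := by
      simp [Matrix.IsSymm, Matrix.transpose_mul, Matrix.mul_assoc]
    have hm : mdot (P * Matrix.diagonal σ * P.transpose) ξ = isoGamma a b * t ^ 2 := by
      rw [hξ, mdot_diagonal_diagonal hP]
      simp only [σ, mul_assoc, sign_mul_self]
      rw [ht]
      ring
    have hle := jk_isoQuad_le hb hab hP hσ
    have hge := upper _ hz
    exact ⟨_, hz, by linarith⟩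
  · rintro x ⟨z, hz, rfl⟩
    exact upper z hz
end
end
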